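/- arXiv:2206.02108 — 3 statements merged into one kernel-verified Lean document; each statement's English description precedes it below -/
import Mathlib

section
/- Let ρ : (0,∞) → ℝ be Lebesgue integrable on (0,∞), let μ > -1, and suppose there is a constant C' ≠ 0 such that lim_{t→0+} t^{-μ} ρ(t) = C'. Then the Laplace transform of ρ satisfies lim_{p→∞} p^{μ+1} ρ̂(p) = C'·Γ(μ+1); in particular ρ̂(p) behaves like a nonzero constant times p^{-μ-1} as p → ∞. -/
open MeasureTheory Set Filter

theorem integrableOn_exp_neg_mul_mul_rpow {μ p : ℝ} (hμ : -1 < μ) (hp : 0 < p) :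
    IntegrableOn (fun t : ℝ => Real.exp (-p * t) * t ^ μ) (Ioi 0) := by
  have h := integrableOn_rpow_mul_exp_neg_mul_rpow (s := μ) (p := 1) hμ one_pos hp
  simpa [mul_comm] using h

theorem rpow_mul_integral_exp_neg_mul_mul_rpow {μ p : ℝ} (hμ : -1 < μ) (hp : 0 < p) :
    p ^ (μ + 1) * ∫ t in Ioi (0 : ℝ), Real.exp (-p * t) * t ^ μ = Real.Gamma (μ + 1) := by
  have h := Real.integral_rpow_mul_exp_neg_mul_Ioi (a := μ + 1) (r := p) (by linarith) hp
  have hpp : 0 < p ^ (μ + 1) := Real.rpow_pos_of_pos hp _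
  simp only [add_sub_cancel_right, one_div, Real.inv_rpow hp.le] at h
  simp only [neg_mul, mul_comm (Real.exp _), h]
  field_simp

theorem integrableOn_exp_neg_mul_mul {ρ : ℝ → ℝ} (hρ : IntegrableOn ρ (Ioi 0)) {p : ℝ}
    (hp : 0 ≤ p) : IntegrableOn (fun t : ℝ => Real.exp (-p * t) * ρ t) (Ioi 0) := by
  refine Integrable.bdd_mul (c := 1) hρ (by fun_prop) ?_
  filter_upwards [ae_restrict_mem measurableSet_Ioi] with t ht
  rw [Real.norm_eq_abs, Real.abs_exp, Real.exp_le_one_iff]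
  nlinarith [mul_nonneg hp (le_of_lt ht)]

theorem tendsto_rpow_mul_exp_neg_sub_one_mul (s B : ℝ) {δ : ℝ} (hδ : 0 < δ) :
    Tendsto (fun p : ℝ => p ^ s * (Real.exp (-(p - 1) * δ) * B)) atTop (nhds 0) := by
  have h := (tendsto_rpow_mul_exp_neg_mul_atTop_nhds_zero s δ hδ).mul_const (Real.exp δ * B)
  rw [zero_mul] at h
  refine h.congr fun p => ?_
  rw [show -(p - 1) * δ = -δ * p + δ by ring, Real.exp_add]
  ring

/-- A function that is `ε t ^ μ`-close to `C t ^ μ` on `(0, δ)` has its Laplace integrand close to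
that of `C t ^ μ`, up to a term that decays exponentially in `p`. -/
theorem abs_exp_neg_mul_mul_sub_le {ρ : ℝ → ℝ} {μ C ε δ p t : ℝ} (hε : 0 ≤ ε) (hp : 1 ≤ p)
    (ht : 0 < t) (h : t < δ → |t ^ (-μ) * ρ t - C| ≤ ε) :
    |Real.exp (-p * t) * ρ t - C * (Real.exp (-p * t) * t ^ μ)| ≤
      ε * (Real.exp (-p * t) * t ^ μ) +
        Real.exp (-(p - 1) * δ) * (Real.exp (-1 * t) * (|ρ t| + |C| * t ^ μ)) := by
  have hpos : 0 < t ^ μ := Real.rpow_pos_of_pos ht _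
  have hfac : Real.exp (-p * t) * ρ t - C * (Real.exp (-p * t) * t ^ μ) =
      Real.exp (-p * t) * (ρ t - C * t ^ μ) := by ring
  rw [hfac, abs_mul, Real.abs_exp]
  rcases lt_or_ge t δ with htδ | htδ
  · have hρ : ρ t - C * t ^ μ = (t ^ (-μ) * ρ t - C) * t ^ μ := by
      rw [Real.rpow_neg ht.le]
      field_simp
    have hle : |ρ t - C * t ^ μ| ≤ ε * t ^ μ := by
      rw [hρ, abs_mul, abs_of_pos hpos]
      exact mul_le_mul_of_nonneg_right (h htδ) hpos.le
    calc Real.exp (-p * t) * |ρ t - C * t ^ μ| ≤ Real.exp (-p * t) * (ε * t ^ μ) := by gcongr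
      _ = ε * (Real.exp (-p * t) * t ^ μ) := by ring
      _ ≤ _ := le_add_of_nonneg_right (by positivity)
  · have hle : |ρ t - C * t ^ μ| ≤ |ρ t| + |C| * t ^ μ := by
      simpa [abs_mul, abs_of_pos hpos] using abs_sub (ρ t) (C * t ^ μ)
    have hexp : Real.exp (-p * t) ≤ Real.exp (-(p - 1) * δ) * Real.exp (-1 * t) := by
      rw [← Real.exp_add, Real.exp_le_exp]
      nlinarith [mul_nonneg (sub_nonneg.2 hp) (sub_nonneg.2 htδ)]
    calc Real.exp (-p * t) * |ρ t - C * t ^ μ|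
        ≤ (Real.exp (-(p - 1) * δ) * Real.exp (-1 * t)) * (|ρ t| + |C| * t ^ μ) := by gcongr
      _ = Real.exp (-(p - 1) * δ) * (Real.exp (-1 * t) * (|ρ t| + |C| * t ^ μ)) := by ring
      _ ≤ _ := le_add_of_nonneg_left (by positivity)

theorem abs_rpow_mul_laplace_sub_le {ρ : ℝ → ℝ} (hρ : IntegrableOn ρ (Ioi 0)) {μ C ε δ p : ℝ}
    (hμ : -1 < μ) (hε : 0 ≤ ε) (hp : 1 ≤ p)
    (h : ∀ t, 0 < t → t < δ → |t ^ (-μ) * ρ t - C| ≤ ε) :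
    |p ^ (μ + 1) * (∫ t in Ioi (0 : ℝ), Real.exp (-p * t) * ρ t) - C * Real.Gamma (μ + 1)| ≤
      ε * Real.Gamma (μ + 1) + p ^ (μ + 1) * (Real.exp (-(p - 1) * δ) *
        ∫ t in Ioi (0 : ℝ), Real.exp (-1 * t) * (|ρ t| + |C| * t ^ μ)) := by
  have hp0 : 0 < p := by linarith
  have hpp : 0 < p ^ (μ + 1) := Real.rpow_pos_of_pos hp0 _
  have hK := integrableOn_exp_neg_mul_mul_rpow hμ hp0
  have hL := integrableOn_exp_neg_mul_mul hρ hp0.le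
  have hB : IntegrableOn (fun t : ℝ => Real.exp (-1 * t) * (|ρ t| + |C| * t ^ μ)) (Ioi 0) := by
    refine ((integrableOn_exp_neg_mul_mul hρ.abs zero_le_one).add
      ((integrableOn_exp_neg_mul_mul_rpow hμ one_pos).const_mul |C|)).congr
      (Eventually.of_forall fun t => ?_)
    simp only [Pi.add_apply]
    ring
  have hbound : |(∫ t in Ioi (0 : ℝ), Real.exp (-p * t) * ρ t) -
      C * ∫ t in Ioi (0 : ℝ), Real.exp (-p * t) * t ^ μ| ≤
      ε * (∫ t in Ioi (0 : ℝ), Real.exp (-p * t) * t ^ μ) + Real.exp (-(p - 1) * δ) *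
        ∫ t in Ioi (0 : ℝ), Real.exp (-1 * t) * (|ρ t| + |C| * t ^ μ) := by
    rw [← integral_const_mul, ← integral_const_mul, ← integral_const_mul,
      ← integral_sub hL (hK.const_mul C), ← integral_add (hK.const_mul ε) (hB.const_mul _),
      ← Real.norm_eq_abs]
    refine norm_integral_le_of_norm_le ((hK.const_mul ε).add (hB.const_mul _)) ?_
    filter_upwards [ae_restrict_mem measurableSet_Ioi] with t ht
    exact abs_exp_neg_mul_mul_sub_le hε hp ht (h t ht)
  rw [← rpow_mul_integral_exp_neg_mul_mul_rpow hμ hp0, mul_left_comm C, mul_left_comm ε,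
    ← mul_sub, ← mul_add, abs_mul, abs_of_pos hpp]
  exact mul_le_mul_of_nonneg_left hbound hpp.le

/-- Lemma 4.2: if `ρ` is integrable on `(0,∞)` and `ρ(t) ~ C' t^μ` as `t → 0+`
with `μ > -1` and `C' ≠ 0`, then `p^(μ+1) ρ̂(p) → C'·Γ(μ+1)` as `p → ∞`,
and the limit is a nonzero constant. -/
theorem laplace_asymptotic_of_power_behavior
    (ρ : ℝ → ℝ) (hρ : IntegrableOn ρ (Ioi 0))
    (μ : ℝ) (hμ : -1 < μ) (C' : ℝ) (hC' : C' ≠ 0)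
    (hlim : Tendsto (fun t : ℝ => t ^ (-μ) * ρ t) (nhdsWithin 0 (Ioi 0)) (nhds C')) :
    Tendsto (fun p : ℝ => p ^ (μ + 1) * ∫ t in Ioi (0 : ℝ), Real.exp (-p * t) * ρ t)
        atTop (nhds (C' * Real.Gamma (μ + 1))) ∧
      C' * Real.Gamma (μ + 1) ≠ 0 := by
  have hΓ : 0 < Real.Gamma (μ + 1) := Real.Gamma_pos_of_pos (by linarith)
  refine ⟨?_, mul_ne_zero hC' hΓ.ne'⟩
  rw [Metric.tendsto_nhds]
  intro η hη
  set ε := η / (2 * Real.Gamma (μ + 1)) with hεdef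
  have hε : 0 < ε := by positivity
  have hεΓ : ε * Real.Gamma (μ + 1) = η / 2 := by
    rw [hεdef]
    field_simp
  obtain ⟨δ, hδ, hclose⟩ :=
    mem_nhdsGT_iff_exists_Ioo_subset.1 (Metric.tendsto_nhds.1 hlim ε hε)
  have htail := tendsto_rpow_mul_exp_neg_sub_one_mul (μ + 1)
    (∫ t in Ioi (0 : ℝ), Real.exp (-1 * t) * (|ρ t| + |C'| * t ^ μ)) hδ
  filter_upwards [eventually_ge_atTop 1, htail.eventually_lt_const (half_pos hη)] with p hp hsmall
  have h := abs_rpow_mul_laplace_sub_le hρ hμ hε.le hp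
    fun t ht htδ => (hclose ⟨ht, htδ⟩ : dist _ C' < ε).le
  rw [Real.dist_eq]
  linarith
end

section
/- Let α, β ∈ (0,1), let A ≠ 0, B ≠ 0 and c be real numbers, let ν > min{α, β} and C > 0, let (t_m)_{m∈ℕ} be a sequence of positive reals with t_m → 0, and let R : (0,∞) → ℝ satisfy |R(t)| ≤ C (t^{2α} + t^{2β}) for all t ∈ (0,1). If |c − A t_m^α + B t_m^β + R(t_m)| ≤ C t_m^{ν} for every m ∈ ℕ, then c = 0, α = β, and A = B. -/
open Set Filter

/-- If `t m → 0`, then `t m ^ p → 0` for every positive exponent `p`. -/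
theorem tendsto_rpow_zero_of_pos {t : ℕ → ℝ} (ht_lim : Tendsto t atTop (nhds 0))
    {p : ℝ} (hp : 0 < p) : Tendsto (fun m => t m ^ p) atTop (nhds 0) := by
  simpa [Real.zero_rpow hp.ne'] using ht_lim.rpow_const (p := p) (Or.inr hp.le)

/-- The two-term expansion divided by `t m ^ γ` tends to zero, for every exponent `γ` below the
orders of the remainder and of the sampling error. -/
theorem tendsto_rescaled_expansion {α β ν γ A B c C : ℝ} {t : ℕ → ℝ}
    (ht_pos : ∀ m : ℕ, 0 < t m) (ht_lim : Tendsto t atTop (nhds 0)) {R : ℝ → ℝ}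
    (hR : ∀ s : ℝ, 0 < s → s < 1 → |R s| ≤ C * (s ^ (2 * α) + s ^ (2 * β)))
    (hyp : ∀ m : ℕ, |c - A * t m ^ α + B * t m ^ β + R (t m)| ≤ C * t m ^ ν)
    (hγν : γ < ν) (hγα : γ < 2 * α) (hγβ : γ < 2 * β) :
    Tendsto (fun m => c * t m ^ (-γ) - A * t m ^ (α - γ) + B * t m ^ (β - γ))
      atTop (nhds 0) := by
  have hbound : Tendsto
      (fun m => C * (t m ^ (ν - γ) + t m ^ (2 * α - γ) + t m ^ (2 * β - γ))) atTop (nhds 0) := by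
    simpa using (((tendsto_rpow_zero_of_pos ht_lim (sub_pos.2 hγν)).add
      (tendsto_rpow_zero_of_pos ht_lim (sub_pos.2 hγα))).add
      (tendsto_rpow_zero_of_pos ht_lim (sub_pos.2 hγβ))).const_mul C
  refine squeeze_zero_norm' ?_ hbound
  filter_upwards [ht_lim.eventually_lt_const one_pos] with m hm
  have hpos := Real.rpow_pos_of_pos (ht_pos m) (-γ)
  have htri : |c - A * t m ^ α + B * t m ^ β|
      ≤ C * (t m ^ ν + t m ^ (2 * α) + t m ^ (2 * β)) := by
    have h₁ := abs_le.1 (hyp m)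
    have h₂ := abs_le.1 (hR (t m) (ht_pos m) hm)
    exact abs_le.2 ⟨by linarith [h₁.1, h₂.2], by linarith [h₁.2, h₂.1]⟩
  have hmul := mul_le_mul_of_nonneg_right htri hpos.le
  simp only [sub_eq_add_neg _ γ, Real.rpow_add (ht_pos m), Real.norm_eq_abs]
  calc _ = |(c - A * t m ^ α + B * t m ^ β) * t m ^ (-γ)| := by congr 1; ring
    _ = |c - A * t m ^ α + B * t m ^ β| * t m ^ (-γ) := by rw [abs_mul, abs_of_pos hpos]
    _ ≤ _ := hmul
    _ = _ := by ring

/-- The calibration lemma of Section 5: comparing two-term short-time expansions along a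
sequence of sampling times `t_m → 0` with error bound `C t_m^ν`, `ν > min{α,β}`,
forces `c = 0`, `α = β` and `A = B`. -/
theorem sampling_calibration
    (α β : ℝ) (hα0 : 0 < α) (hα1 : α < 1) (hβ0 : 0 < β) (hβ1 : β < 1)
    (A B c : ℝ) (hA : A ≠ 0) (hB : B ≠ 0)
    (ν : ℝ) (hν : min α β < ν) (C : ℝ) (hC : 0 < C)
    (t : ℕ → ℝ) (ht_pos : ∀ m : ℕ, 0 < t m)
    (ht_lim : Tendsto t atTop (nhds 0))
    (R : ℝ → ℝ)
    (hR : ∀ s : ℝ, 0 < s → s < 1 → |R s| ≤ C * (s ^ (2 * α) + s ^ (2 * β)))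
    (hyp : ∀ m : ℕ, |c - A * t m ^ α + B * t m ^ β + R (t m)| ≤ C * t m ^ ν) :
    c = 0 ∧ α = β ∧ A = B := by
  have hc : c = 0 := by
    have h := tendsto_rescaled_expansion (γ := 0) ht_pos ht_lim hR hyp
      ((lt_min hα0 hβ0).trans hν) (by linarith) (by linarith)
    have h' : Tendsto (fun m => c * t m ^ (-0 : ℝ) - A * t m ^ (α - 0) + B * t m ^ (β - 0))
        atTop (nhds c) := by
      simpa using ((tendsto_rpow_zero_of_pos ht_lim hα0).const_mul A).const_sub c |>.add
        ((tendsto_rpow_zero_of_pos ht_lim hβ0).const_mul B)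
    exact tendsto_nhds_unique h' h
  subst hc
  refine ⟨rfl, ?_⟩
  rcases lt_trichotomy α β with hlt | rfl | hlt
  · rw [min_eq_left hlt.le] at hν
    have h := tendsto_rescaled_expansion ht_pos ht_lim hR hyp hν (by linarith) (by linarith)
    have h' := ((tendsto_rpow_zero_of_pos ht_lim (sub_pos.2 hlt)).const_mul B).const_add (-A)
    simp only [zero_mul, zero_sub, sub_self, Real.rpow_zero, mul_one] at h
    exact absurd (tendsto_nhds_unique h' h) (by simpa using hA)
  · rw [min_self] at hν
    have h := tendsto_rescaled_expansion ht_pos ht_lim hR hyp hν (by linarith) (by linarith)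
    simp only [zero_mul, zero_sub, sub_self, Real.rpow_zero, mul_one] at h
    exact ⟨rfl, by linarith [tendsto_nhds_unique tendsto_const_nhds h]⟩
  · rw [min_eq_right hlt.le] at hν
    have h := tendsto_rescaled_expansion ht_pos ht_lim hR hyp hν (by linarith) (by linarith)
    have h' := ((tendsto_rpow_zero_of_pos ht_lim (sub_pos.2 hlt)).const_mul A).neg.add_const B
    simp only [zero_mul, zero_sub, sub_self, Real.rpow_zero, mul_one] at h
    exact absurd (tendsto_nhds_unique h' h) (by simpa using hB)
end

section
/- Let (λ_n)_{n∈ℕ} be a strictly increasing sequence of positive reals, let κ > 0, and let (c_n)_{n∈ℕ} and (d_n)_{n∈ℕ} be real sequences with Σ_n |c_n| < ∞ and Σ_n |d_n| < ∞. Suppose Σ_{n} c_n/(λ_n + x) = Σ_{n} d_n/(κ λ_n + x) for every x > 0. Then for every n ∈ ℕ: if there exists n' ∈ ℕ with λ_n = κ λ_{n'}, then c_n = d_{n'}; and if no such n' exists, then c_n = 0. Symmetrically, for every n' ∈ ℕ, if κ λ_{n'} ∉ {λ_k : k ∈ ℕ} then d_{n'} = 0. -/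
open Set Filter

/-- A power series `∑ mₖ yᵏ` vanishing near the origin has zero coefficients; here the `mₖ` are the
moments of the summable family of weights `v` at the points `s`. -/
lemma tsum_mul_pow_eq_zero_of_tsum_div_eq_zero {ι : Type*} {v s : ι → ℝ}
    (hv : Summable fun i => |v i|) (hs : ∀ i, s i ∈ Ioo (0 : ℝ) 1)
    (h : ∀ y : ℝ, |y| < 1 → ∑' i, v i / (1 - y * s i) = 0) (k : ℕ) :
    ∑' i, v i * s i ^ k = 0 := by
  have key : HasFPowerSeriesAt (0 : ℝ → ℝ)
      (FormalMultilinearSeries.ofScalars ℝ fun k => ∑' i, v i * s i ^ k) 0 := by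
    rw [hasFPowerSeriesAt_iff]
    filter_upwards [Metric.ball_mem_nhds (0 : ℝ) one_pos] with y hy
    have hy : |y| < 1 := by simpa using hy
    have hys : ∀ i, |y * s i| ≤ |y| := fun i => by
      rw [abs_mul, abs_of_pos (hs i).1]
      exact mul_le_of_le_one_right (abs_nonneg y) (hs i).2.le
    have hsum : Summable fun q : ℕ × ι => v q.2 * (y * s q.2) ^ q.1 := by
      refine Summable.of_norm_bounded
        ((summable_geometric_of_lt_one (abs_nonneg y) hy).mul_of_nonneg hv
          (fun k => pow_nonneg (abs_nonneg y) k) fun i => abs_nonneg (v i)) fun q => ?_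
      rw [Real.norm_eq_abs, abs_mul, abs_pow, mul_comm]
      exact mul_le_mul_of_nonneg_right (pow_le_pow_left₀ (abs_nonneg _) (hys _) _) (abs_nonneg _)
    have hfib : ∀ i, HasSum (fun k : ℕ => v i * (y * s i) ^ k) (v i / (1 - y * s i)) := fun i =>
      (hasSum_geometric_of_abs_lt_one ((hys i).trans_lt hy)).mul_left (v i)
    have htot : ∑' q : ℕ × ι, v q.2 * (y * s q.2) ^ q.1 = 0 := by
      rw [hsum.tsum_prod, ← h y hy]
      exact (Summable.tsum_comm (f := fun i k => v i * (y * s i) ^ k) hsum.prod_symm).trans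
        (tsum_congr fun i => (hfib i).tsum_eq)
    have hrow := hsum.hasSum.prod_fiberwise fun k => (hsum.prod_factor k).hasSum
    rw [htot] at hrow
    refine hrow.congr_fun fun k => ?_
    rw [FormalMultilinearSeries.coeff_ofScalars, smul_eq_mul, ← tsum_mul_left]
    exact tsum_congr fun i => by rw [mul_pow]; ring
  have h0 := congrArg (fun p => p.coeff k) key.eq_zero
  exact FormalMultilinearSeries.coeff_ofScalars.symm.trans h0

/-- A summable family of weights on `(0, 1)` all of whose moments vanish has no atoms. -/
lemma tsum_ite_eq_zero_of_tsum_mul_pow_eq_zero {ι : Type*} {v s : ι → ℝ}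
    (hv : Summable fun i => |v i|) (hs : ∀ i, s i ∈ Ioo (0 : ℝ) 1)
    (h : ∀ k : ℕ, ∑' i, v i * s i ^ k = 0) {a : ℝ} (ha : a ∈ Ioo (0 : ℝ) 1) :
    ∑' i, (if s i = a then v i else 0) = 0 := by
  have hpow : ∀ k : ℕ, Summable fun i => v i * s i ^ k := fun k =>
    Summable.of_norm_bounded hv fun i => by
      rw [Real.norm_eq_abs, abs_mul, abs_pow, abs_of_pos (hs i).1]
      exact mul_le_of_le_one_right (abs_nonneg _) (pow_le_one₀ (hs i).1.le (hs i).2.le)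
  have hpoly : ∀ P : Polynomial ℝ, ∑' i, v i * P.eval (s i) = 0 := fun P => by
    simp_rw [Polynomial.eval_eq_sum_range, Finset.mul_sum, mul_left_comm (v _)]
    rw [Summable.tsum_finsetSum fun k _ => (hpow k).mul_left _]
    simp [tsum_mul_left, h]
  have hbd : ∀ i, 0 ≤ 1 - (s i - a) ^ 2 ∧ 1 - (s i - a) ^ 2 ≤ 1 := fun i => by
    obtain ⟨h1, h2⟩ := hs i
    obtain ⟨h3, h4⟩ := ha
    constructor <;> nlinarith
  have hlim : Tendsto (fun n : ℕ => ∑' i, v i * (1 - (s i - a) ^ 2) ^ n) atTop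
      (nhds (∑' i, (if s i = a then v i else 0))) := by
    refine tendsto_tsum_of_dominated_convergence hv (fun i => ?_) (Eventually.of_forall fun n i => ?_)
    · split_ifs with hi
      · simp [hi]
      · have hlt : 1 - (s i - a) ^ 2 < 1 := sub_lt_self _ (by have := sub_ne_zero.2 hi; positivity)
        simpa using (tendsto_pow_atTop_nhds_zero_of_lt_one (hbd i).1 hlt).const_mul (v i)
    · rw [Real.norm_eq_abs, abs_mul, abs_pow, abs_of_nonneg (hbd i).1]
      exact mul_le_of_le_one_right (abs_nonneg _) (pow_le_one₀ (hbd i).1 (hbd i).2)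
  have hzero : ∀ n : ℕ, ∑' i, v i * (1 - (s i - a) ^ 2) ^ n = 0 := fun n => by
    rw [← hpoly ((1 - (Polynomial.X - Polynomial.C a) ^ 2) ^ n)]
    exact tsum_congr fun i => by rw [Polynomial.eval_pow]; simp
  simp_rw [hzero] at hlim
  exact tendsto_nhds_unique hlim tendsto_const_nhds

/-- A summable family of weights on `(0, ∞)` whose Stieltjes transform vanishes has no atoms. -/
lemma tsum_ite_eq_zero_of_stieltjes_eq_zero {ι : Type*} {w p : ι → ℝ}
    (hw : Summable fun i => |w i|) (hp : ∀ i, 0 < p i)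
    (h : ∀ x : ℝ, 0 < x → ∑' i, w i / (p i + x) = 0) {a : ℝ} (ha : 0 < a) :
    ∑' i, (if p i = a then w i else 0) = 0 := by
  have hinv : ∀ t : ℝ, 0 < t → (t + 1)⁻¹ ∈ Ioo (0 : ℝ) 1 := fun t ht =>
    ⟨by positivity, inv_lt_one_of_one_lt₀ (by linarith)⟩
  have hv : Summable fun i => |w i * (p i + 1)⁻¹| :=
    Summable.of_nonneg_of_le (fun i => abs_nonneg _) (fun i => by
      rw [abs_mul, abs_of_pos (hinv _ (hp i)).1]
      exact mul_le_of_le_one_right (abs_nonneg _) (hinv _ (hp i)).2.le) hw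
  have hatom := tsum_ite_eq_zero_of_tsum_mul_pow_eq_zero hv (fun i => hinv _ (hp i))
    (tsum_mul_pow_eq_zero_of_tsum_div_eq_zero hv (fun i => hinv _ (hp i)) fun y hy => by
      have hy1 : 0 < 1 - y := by linarith [(abs_lt.1 hy).2]
      rw [← h (1 - y) hy1]
      refine tsum_congr fun i => ?_
      have h1 : p i + 1 ≠ 0 := by linarith [hp i]
      have h2 : p i + (1 - y) ≠ 0 := by linarith [hp i]
      have h3 : 1 - y * (p i + 1)⁻¹ = (p i + (1 - y)) / (p i + 1) := by
        field_simp
        ring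
      rw [h3]
      field_simp) (hinv a ha)
  have hcongr : ∀ i, (if (p i + 1)⁻¹ = (a + 1)⁻¹ then w i * (p i + 1)⁻¹ else 0) =
      (if p i = a then w i else 0) * (a + 1)⁻¹ := fun i => by
    simp only [inv_inj, add_left_inj]
    split_ifs with hi <;> simp [hi]
  simp_rw [hcongr, tsum_mul_right] at hatom
  exact (mul_eq_zero.1 hatom).resolve_right (hinv a ha).1.ne'

lemma summable_div_add {ι : Type*} {w p : ι → ℝ} (hw : Summable fun i => |w i|)
    (hp : ∀ i, 0 < p i) {x : ℝ} (hx : 0 < x) : Summable fun i => w i / (p i + x) :=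
  Summable.of_norm_bounded (hw.mul_right x⁻¹) fun i => by
    have hpi := hp i
    rw [Real.norm_eq_abs, abs_div, abs_of_pos (by positivity : 0 < p i + x), div_eq_mul_inv]
    gcongr
    linarith

/-- Two summable families of weights on `(0, ∞)` with equal Stieltjes transforms have the same
atoms. -/
lemma tsum_ite_eq_tsum_ite_of_stieltjes_eq {ι κ : Type*} {c p : ι → ℝ} {d q : κ → ℝ}
    (hc : Summable fun i => |c i|) (hd : Summable fun j => |d j|)
    (hp : ∀ i, 0 < p i) (hq : ∀ j, 0 < q j)
    (h : ∀ x : ℝ, 0 < x → ∑' i, c i / (p i + x) = ∑' j, d j / (q j + x)) {a : ℝ} (ha : 0 < a) :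
    ∑' i, (if p i = a then c i else 0) = ∑' j, (if q j = a then d j else 0) := by
  have hw : Summable fun i => |Sum.elim c (fun j => -d j) i| :=
    Summable.sum _ hc (by simpa [Function.comp_def] using hd)
  have hatom := tsum_ite_eq_zero_of_stieltjes_eq_zero (p := Sum.elim p q) hw
    (Sum.forall.2 ⟨hp, hq⟩) (fun x hx => by
      have hdiv := summable_div_add hw (Sum.forall.2 ⟨hp, hq⟩ : ∀ i, 0 < Sum.elim p q i) hx
      rw [Summable.tsum_sum (hdiv.comp_injective Sum.inl_injective)
        (hdiv.comp_injective Sum.inr_injective)]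
      simp only [Sum.elim_inl, Sum.elim_inr, neg_div, tsum_neg, h x hx, add_neg_cancel]) ha
  have hite : Summable fun i => if Sum.elim p q i = a then Sum.elim c (fun j => -d j) i else 0 :=
    Summable.of_norm_bounded hw fun i => by split_ifs <;> simp
  rw [Summable.tsum_sum (hite.comp_injective Sum.inl_injective)
    (hite.comp_injective Sum.inr_injective)] at hatom
  rw [← sub_eq_zero, sub_eq_add_neg, ← tsum_neg]
  refine Eq.trans (congrArg _ (tsum_congr fun j => ?_)) hatom
  by_cases hj : q j = a <;> simp [hj]

/-- Partial-fraction matching (analytic core of Theorem 3.4): if two absolutely convergent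
partial-fraction series `Σ c_n/(λ_n + x)` and `Σ d_n/(κλ_n + x)` agree for all `x > 0`,
then residues match: `c_n = d_{n'}` whenever `λ_n = κ λ_{n'}`, `c_n = 0` if `λ_n` has no
partner `κ λ_{n'}`, and `d_{n'} = 0` if `κ λ_{n'}` is not in the `λ`-spectrum. -/
theorem partial_fraction_matching
    (lam : ℕ → ℝ) (hmono : StrictMono lam) (hpos : ∀ n : ℕ, 0 < lam n)
    (κ : ℝ) (hκ : 0 < κ)
    (c d : ℕ → ℝ)
    (hc : Summable (fun n : ℕ => |c n|)) (hd : Summable (fun n : ℕ => |d n|))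
    (heq : ∀ x : ℝ, 0 < x →
      ∑' n : ℕ, c n / (lam n + x) = ∑' n : ℕ, d n / (κ * lam n + x)) :
    (∀ n : ℕ, (∀ n' : ℕ, lam n = κ * lam n' → c n = d n') ∧
      ((¬ ∃ n' : ℕ, lam n = κ * lam n') → c n = 0)) ∧
    (∀ n' : ℕ, (¬ ∃ k : ℕ, κ * lam n' = lam k) → d n' = 0) := by
  have atom : ∀ a : ℝ, 0 < a → ∑' n, (if lam n = a then c n else 0) =
      ∑' n, (if κ * lam n = a then d n else 0) := fun a ha =>
    tsum_ite_eq_tsum_ite_of_stieltjes_eq hc hd hpos (fun n => mul_pos hκ (hpos n)) heq ha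
  have left : ∀ n, ∑' m, (if lam m = lam n then c m else 0) = c n := fun n => by
    simp [hmono.injective.eq_iff]
  have right : ∀ n, ∑' m, (if κ * lam m = κ * lam n then d m else 0) = d n := fun n => by
    simp [hmono.injective.eq_iff, hκ.ne']
  refine ⟨fun n => ⟨fun n' hn => ?_, fun hn => ?_⟩, fun n' hn => ?_⟩
  · rw [← left n, ← right n', ← hn]
    exact atom _ (hpos n)
  · rw [← left n, atom _ (hpos n)]
    exact tsum_congr (fun m => if_neg fun hm => hn ⟨m, hm.symm⟩) |>.trans tsum_zero
  · rw [← right n', ← atom _ (mul_pos hκ (hpos n'))]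
    exact tsum_congr (fun m => if_neg fun hm => hn ⟨m, hm.symm⟩) |>.trans tsum_zero
end
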